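/- arXiv:2603.14754 — 4 statements merged into one kernel-verified Lean document; each statement's English description precedes it below -/
import Mathlib

section
/- Let Q = (V, E, ȳ) be a free-connex conjunctive query with unique-attribute set V•, and let Q1 = (V1, E1, ȳ1) and Q2 = (V2, E2, ȳ2) be two residual queries of Q (arising from two skeletons of Q). Then for every atom R(x̄) ∈ E1, either R(x̄) ∈ E2, or there exists an atom R'(x̄') ∈ E2 such that R'(x̄') ∉ E1 and x̄ \ V• = x̄' \ V•. -/
open Finset

/-- A conjunctive query `Q = (V, E, ȳ)`: a finite set `V` of attributes,
a finite set `E` of relation atoms (drawn from the type `ρ` of atom names),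
a schema map assigning to each atom its set of attributes, and a set `y ⊆ V`
of output attributes. -/
structure CQ (α : Type) (ρ : Type) where
  V : Finset α
  E : Finset ρ
  schema : ρ → Finset α
  y : Finset α
  schema_sub : ∀ R ∈ E, schema R ⊆ V
  y_sub : y ⊆ V

namespace CQ

variable {α ρ : Type} [DecidableEq α] [DecidableEq ρ]

/-- `E[x]`: the set of atoms whose schema contains `x`. -/
def atoms (Q : CQ α ρ) (x : α) : Finset ρ :=
  Q.E.filter (fun R => x ∈ Q.schema R)

/-- `V•`: the set of unique attributes, i.e. those contained in exactly one atom. -/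
def uniq (Q : CQ α ρ) : Finset α :=
  Q.V.filter (fun x => (Q.atoms x).card = 1)

/-- `R'` is an anchor of the ear `R`. -/
def IsAnchor (Q : CQ α ρ) (R R' : ρ) : Prop :=
  R ∈ Q.E ∧ R' ∈ Q.E ∧ R' ≠ R ∧
    ((Q.schema R \ Q.uniq ⊆ Q.schema R' ∧ Q.schema R ∩ Q.uniq ⊆ Q.V \ Q.y) ∨
      Q.schema R \ Q.uniq ⊆ Q.schema R' ∩ Q.y)

/-- `R` is an ear of `Q`. -/
def IsEar (Q : CQ α ρ) (R : ρ) : Prop := ∃ R', Q.IsAnchor R R'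

/-- One step of the skeleton reduction: remove an ear (of the original query `Q`)
whose anchor is still present in the current set. -/
def Step (Q : CQ α ρ) (S S' : Finset ρ) : Prop :=
  ∃ R ∈ S, Q.IsEar R ∧ (∃ R' ∈ S, Q.IsAnchor R R') ∧ S' = S.erase R

/-- `S` is a skeleton of `Q`: it is reachable from `E` by reduction steps and
no further step is possible. -/
def IsSkeleton (Q : CQ α ρ) (S : Finset ρ) : Prop :=
  Relation.ReflTransGen Q.Step Q.E S ∧ ∀ S', ¬ Q.Step S S'

/-- The `S`-induced (residual) query `(V*, S, ȳ ∩ V*)` where `V*` is the set of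
attributes occurring in `S`. -/
def residual (Q : CQ α ρ) (S : Finset ρ) : CQ α ρ where
  V := S.biUnion Q.schema
  E := S
  schema := Q.schema
  y := Q.y ∩ S.biUnion Q.schema
  schema_sub := fun R hR _ hx => Finset.mem_biUnion.mpr ⟨R, hR, hx⟩
  y_sub := Finset.inter_subset_right

end CQ

/-- `Anc parent w v`: `w` is an ancestor of `v` (possibly `w = v`) in the rooted
tree given by the parent map. -/
def Anc {N : Type} (parent : N → N) (w v : N) : Prop := ∃ n : ℕ, parent^[n] v = w

/-- `OnPath parent u v w`: `w` lies on the unique tree path between `u` and `v`. -/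
def OnPath {N : Type} (parent : N → N) (u v w : N) : Prop :=
  (Anc parent w u ∨ Anc parent w v) ∧ ∀ z, Anc parent z u → Anc parent z v → Anc parent z w

/-- A generalized join tree (GJT) of the conjunctive query `Q`: a finite rooted tree
whose nodes are labelled either by input relations of `Q` or by generalized relations
(subsets of some atom's schema), satisfying the Cover property (every atom occurs as a
node and every leaf is an input relation) and the Connect property (the nodes containing
a given attribute form a connected subtree). -/
structure GJT {α ρ : Type} [DecidableEq α] [DecidableEq ρ] (Q : CQ α ρ) where
  N : Type
  fin : Fintype N
  root : N
  parent : N → N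
  parent_root : parent root = root
  reach_root : ∀ v, Anc parent root v
  label : N → ρ ⊕ Finset α
  attrs : N → Finset α
  attrs_def : ∀ v, attrs v = Sum.elim Q.schema id (label v)
  label_input_mem : ∀ v R, label v = Sum.inl R → R ∈ Q.E
  label_gen_guarded : ∀ v s, label v = Sum.inr s → ∃ R ∈ Q.E, s ⊆ Q.schema R
  cover : ∀ R ∈ Q.E, ∃ v, label v = Sum.inl R
  leaf_input : ∀ v, (∀ u, parent u = v → u = v) → ∃ R, label v = Sum.inl R
  connect : ∀ x u v w, x ∈ attrs u → x ∈ attrs v → OnPath parent u v w → x ∈ attrs w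

namespace GJT

variable {α ρ : Type} [DecidableEq α] [DecidableEq ρ] {Q : CQ α ρ}

/-- The node is an input-relation node. -/
def IsInput (T : GJT Q) (v : T.N) : Prop := ∃ R, T.label v = Sum.inl R

/-- The node is a generalized-relation node. -/
def IsGen (T : GJT Q) (v : T.N) : Prop := ∃ s, T.label v = Sum.inr s

/-- The height of a GJT: the maximum number of input-relation nodes on any
leaf-to-root path (generalized-relation nodes are not counted). -/
noncomputable def height (T : GJT Q) : ℕ :=
  sSup {n | ∃ v : T.N, n = Set.ncard {w : T.N | Anc T.parent w v ∧ T.IsInput w}}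

/-- The GJT is a free-connex join tree: it additionally satisfies the Above, Guard
and Connex properties. -/
def IsFC (T : GJT Q) : Prop :=
  (∀ u w : T.N, T.IsInput u → T.IsGen w → ¬ Anc T.parent u w) ∧
  (∀ v : T.N, T.IsGen v → ∀ c : T.N, T.parent c = v → c ≠ v → T.attrs v ⊆ T.attrs c) ∧
  (∃ S : Set T.N, T.root ∈ S ∧
    (∀ u ∈ S, ∀ w, Anc T.parent w u → w ∈ S) ∧
    (∀ u ∈ S, u ≠ T.root → T.attrs u ∩ T.attrs (T.parent u) ⊆ Q.y) ∧
    (∀ x ∈ Q.y, ∃ u ∈ S, x ∈ T.attrs u))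

end GJT

namespace CQ

variable {α ρ : Type} [DecidableEq α] [DecidableEq ρ]

/-- `Q` is (α-)acyclic iff it admits a generalized join tree. -/
def IsAcyclic (Q : CQ α ρ) : Prop := Nonempty (GJT Q)

/-- The query obtained from `Q` by adding the output attributes `ȳ` as an extra atom. -/
def extend (Q : CQ α ρ) : CQ α (Option ρ) where
  V := Q.V
  E := insert none (Q.E.image some)
  schema := fun R => match R with
    | none => Q.y
    | some R => Q.schema R
  y := Q.y
  schema_sub := by
    intro R hR
    match R with
    | none => exact Q.y_sub
    | some R =>
      have hRE : R ∈ Q.E := by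
        simp only [Finset.mem_insert, Finset.mem_image, reduceCtorEq, false_or] at hR
        obtain ⟨a, ha, h⟩ := hR
        obtain rfl : a = R := Option.some_injective _ h
        exact ha
      exact Q.schema_sub R hRE
  y_sub := Q.y_sub

/-- `Q` is free-connex: it is acyclic and the query obtained by adding `ȳ` as an
extra atom is acyclic. -/
def IsFreeConnex (Q : CQ α ρ) : Prop := Q.IsAcyclic ∧ Q.extend.IsAcyclic

/-- `IsChordless Q k v e`: the (1-based) vertex sequence `v 1, …, v (k-1)` together
with the edge sequence `e 1, …, e k` is a chordless path of length `k` on the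
relational hypergraph of `Q`. -/
def IsChordless (Q : CQ α ρ) (k : ℕ) (v : ℕ → α) (e : ℕ → ρ) : Prop :=
  if k = 1 then e 1 ∈ Q.E
  else if k = 2 then
    e 1 ∈ Q.E ∧ e 2 ∈ Q.E ∧ e 1 ≠ e 2 ∧ v 1 ∈ Q.V ∧
      v 1 ∈ Q.schema (e 1) ∧ v 1 ∈ Q.schema (e 2)
  else
    3 ≤ k ∧
    (∀ i, 1 ≤ i → i ≤ k → e i ∈ Q.E) ∧
    (∀ i, 1 ≤ i → i ≤ k - 1 → v i ∈ Q.V) ∧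
    (∀ i j, 1 ≤ i → i < j → j ≤ k - 1 → v i ≠ v j) ∧
    (∀ i, 1 ≤ i → i ≤ k - 2 → v i ∈ Q.schema (e (i + 1)) ∧ v (i + 1) ∈ Q.schema (e (i + 1))) ∧
    (∀ i j, 1 ≤ i → i + 1 < j → j ≤ k - 1 → ∀ R ∈ Q.E, ¬(v i ∈ Q.schema R ∧ v j ∈ Q.schema R)) ∧
    (v 1 ∈ Q.schema (e 1) ∧ v 2 ∉ Q.schema (e 1)) ∧
    (v (k - 1) ∈ Q.schema (e k) ∧ v (k - 2) ∉ Q.schema (e k))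

/-- `IsQChordless Q k v e`: q-chordless path of length `k`. -/
def IsQChordless (Q : CQ α ρ) (k : ℕ) (v : ℕ → α) (e : ℕ → ρ) : Prop :=
  if k = 1 then
    e 1 ∈ Q.E ∧ (Q.schema (e 1) ∩ Q.y).Nonempty ∧ (Q.schema (e 1) \ Q.y).Nonempty
  else
    Q.IsChordless k v e ∧
    (∀ i, 1 ≤ i → i ≤ k - 1 → v i ∉ Q.y) ∧
    (∃ i, 1 ≤ i ∧ i ≤ k ∧ v 1 ∈ Q.schema (e i) ∧
      (∀ j, 2 ≤ j → j ≤ k - 1 → v j ∉ Q.schema (e i)) ∧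
      (Q.schema (e i) ∩ Q.y).Nonempty)

/-- `Q`'s relational hypergraph contains a chordless path of length `k`. -/
def HasChordless (Q : CQ α ρ) (k : ℕ) : Prop := ∃ v e, Q.IsChordless k v e

/-- `Q`'s relational hypergraph contains a q-chordless path of length `k`. -/
def HasQChordless (Q : CQ α ρ) (k : ℕ) : Prop := ∃ v e, Q.IsQChordless k v e

/-- `Q` is a height-`k` query. -/
def IsHeight (Q : CQ α ρ) (k : ℕ) : Prop :=
  (∀ m, 2 * k < m → ¬Q.HasChordless m) ∧
  (∀ m, k < m → ¬Q.HasQChordless m) ∧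
  (Q.HasChordless (2 * k) ∨ Q.HasChordless (2 * k - 1) ∨ Q.HasQChordless k)

/-- `Q` is q-hierarchical. -/
def IsQHierarchical (Q : CQ α ρ) : Prop :=
  (∀ x1 ∈ Q.V, ∀ x2 ∈ Q.V,
      Q.atoms x1 ⊆ Q.atoms x2 ∨ Q.atoms x2 ⊆ Q.atoms x1 ∨ Q.atoms x1 ∩ Q.atoms x2 = ∅) ∧
  (∀ x1 ∈ Q.V, ∀ x2 ∈ Q.V, x1 ∈ Q.y → Q.atoms x1 ⊂ Q.atoms x2 → x2 ∈ Q.y)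

/-- One adjacency step in the primal graph restricted to `Vc`. -/
def primalStep (Q : CQ α ρ) (Vc : Finset α) (a b : α) : Prop :=
  a ∈ Vc ∧ b ∈ Vc ∧ ∃ R ∈ Q.E, a ∈ Q.schema R ∧ b ∈ Q.schema R

/-- `Vc` is a connected subset of join attributes. -/
def IsConnSubset (Q : CQ α ρ) (Vc : Finset α) : Prop :=
  Vc ⊆ Q.V \ Q.uniq ∧ ∀ a ∈ Vc, ∀ b ∈ Vc, Relation.ReflTransGen (Q.primalStep Vc) a b

/-- `Ec` is a valid set of active relations induced by the connected subset `Vc`. -/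
def IsActive (Q : CQ α ρ) (Vc : Finset α) (Ec : Finset ρ) : Prop :=
  if Vc = ∅ then ∃ R ∈ Q.E, Ec = {R}
  else Ec = Q.E.filter (fun R => (Q.schema R ∩ Vc).Nonempty)

/-- The active attributes `V★`. -/
def Vstar (Q : CQ α ρ) (Vc : Finset α) (Ec : Finset ρ) : Finset α :=
  Ec.biUnion Q.schema \ Vc

/-- `K` is a key set of a distinct neighbor set `N ⊆ E \ Ec`. -/
def IsKeySet (Q : CQ α ρ) (Vc : Finset α) (Ec : Finset ρ) (Nb : Finset ρ) (K : Finset α) : Prop :=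
  Nb ⊆ Q.E \ Ec ∧ ∃ π : ρ → α,
    (∀ R ∈ Nb, π R ∈ Q.schema R ∧ π R ∈ Q.Vstar Vc Ec) ∧
    Set.InjOn π ↑Nb ∧ K = Nb.image π

/-- The value contributed by a key set to the local dimension. -/
def dimVal (Q : CQ α ρ) (Vc : Finset α) (Ec : Finset ρ) (K : Finset α) : ℕ :=
  if (Vc ∩ Q.y).Nonempty ∨ K ⊆ Q.y then K.card
  else (K ∪ (Q.y ∩ Q.Vstar Vc Ec)).card

/-- The local dimension `dim(Vc)` (with respect to the active relations `Ec`). -/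
noncomputable def localDim (Q : CQ α ρ) (Vc : Finset α) (Ec : Finset ρ) : ℕ :=
  sSup {n | ∃ Nb K, Q.IsKeySet Vc Ec Nb K ∧ n = Q.dimVal Vc Ec K}

/-- The dimension of the query. -/
noncomputable def dim (Q : CQ α ρ) : ℕ :=
  sSup {n | ∃ Vc Ec, Q.IsConnSubset Vc ∧ Q.IsActive Vc Ec ∧ n = Q.localDim Vc Ec}

/-- A Boolean conjunctive query evaluates to true on a database `db` (assigning to each
atom a set of tuples over its schema) iff some assignment of values to all attributes
satisfies every atom of the query. -/
def evalTrue (Q : CQ α ρ) (Dom : Type) (db : (R : ρ) → Set ({x // x ∈ Q.schema R} → Dom)) : Prop :=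
  ∃ a : α → Dom, ∀ R ∈ Q.E, (fun x : {x // x ∈ Q.schema R} => a x.1) ∈ db R

end CQ

namespace CQ

variable {α ρ : Type} [DecidableEq α]

/-- The part of the ear condition on `R` that does not mention the anchor. -/
def EarEligible (Q : CQ α ρ) (R : ρ) : Prop :=
  Q.schema R ∩ Q.uniq ⊆ Q.V \ Q.y ∨ Q.schema R \ Q.uniq ⊆ Q.y

theorem isAnchor_iff (Q : CQ α ρ) (R R' : ρ) :
    Q.IsAnchor R R' ↔ R ∈ Q.E ∧ R' ∈ Q.E ∧ R' ≠ R ∧ Q.EarEligible R ∧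
      Q.schema R \ Q.uniq ⊆ Q.schema R' \ Q.uniq := by
  have hsub : Q.schema R \ Q.uniq ⊆ Q.schema R' \ Q.uniq ↔
      Q.schema R \ Q.uniq ⊆ Q.schema R' :=
    ⟨fun h => h.trans sdiff_subset,
      fun h _ hx => mem_sdiff.2 ⟨h hx, (mem_sdiff.1 hx).2⟩⟩
  rw [hsub, IsAnchor, EarEligible, subset_inter_iff]
  tauto

variable [DecidableEq ρ]

theorem reachable_subset {Q : CQ α ρ} {S : Finset ρ}
    (h : Relation.ReflTransGen Q.Step Q.E S) : S ⊆ Q.E := by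
  induction h with
  | refl => exact Subset.rfl
  | tail _ hstep ih =>
    obtain ⟨R, -, -, -, rfl⟩ := hstep
    exact (erase_subset _ _).trans ih

theorem earEligible_of_notMem_reachable {Q : CQ α ρ} {S : Finset ρ}
    (h : Relation.ReflTransGen Q.Step Q.E S) {R : ρ} (hR : R ∈ Q.E) (hRS : R ∉ S) :
    Q.EarEligible R := by
  induction h with
  | refl => exact absurd hR hRS
  | @tail T _ _ hstep ih =>
    obtain ⟨A, -, ⟨B, hAB⟩, -, rfl⟩ := hstep
    by_cases hRT : R ∈ T
    · obtain rfl : R = A := by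
        by_contra hne
        exact hRS (mem_erase.2 ⟨hne, hRT⟩)
      exact ((Q.isAnchor_iff _ _).1 hAB).2.2.2.1
    · exact ih hRT

theorem exists_dominating_of_reachable {Q : CQ α ρ} {S : Finset ρ}
    (h : Relation.ReflTransGen Q.Step Q.E S) {R : ρ} (hR : R ∈ Q.E) :
    ∃ R' ∈ S, Q.schema R \ Q.uniq ⊆ Q.schema R' \ Q.uniq := by
  induction h with
  | refl => exact ⟨R, hR, Subset.rfl⟩
  | tail _ hstep ih =>
    obtain ⟨A, -, -, ⟨B, hB, hAB⟩, rfl⟩ := hstep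
    obtain ⟨-, -, hne, -, hsub⟩ := (Q.isAnchor_iff _ _).1 hAB
    obtain ⟨R', hR', hRR'⟩ := ih
    by_cases hA : R' = A
    · subst hA
      exact ⟨B, mem_erase.2 ⟨hne, hB⟩, hRR'.trans hsub⟩
    · exact ⟨R', mem_erase.2 ⟨hA, hR'⟩, hRR'⟩

theorem IsSkeleton.eq_of_subset {Q : CQ α ρ} {S : Finset ρ} (h : Q.IsSkeleton S)
    {R R' : ρ} (hR : R ∈ S) (hR' : R' ∈ S) (hel : Q.EarEligible R)
    (hsub : Q.schema R \ Q.uniq ⊆ Q.schema R' \ Q.uniq) : R' = R := by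
  by_contra hne
  have hanchor : Q.IsAnchor R R' := (Q.isAnchor_iff _ _).2
    ⟨reachable_subset h.1 hR, reachable_subset h.1 hR', hne, hel, hsub⟩
  exact h.2 _ ⟨R, hR, ⟨R', hanchor⟩, ⟨R', hR', hanchor⟩, rfl⟩

end CQ

/-- Lemma 2.9. Two residual queries (skeletons) of a free-connex
query agree up to atoms with the same non-unique attributes. -/
theorem residual_queries_agree_up_to_nonunique
    {α ρ : Type} [DecidableEq α] [DecidableEq ρ]
    (Q : CQ α ρ) (hfc : Q.IsFreeConnex)
    (S1 S2 : Finset ρ) (h1 : Q.IsSkeleton S1) (h2 : Q.IsSkeleton S2)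
    (R : ρ) (hR : R ∈ S1) :
    R ∈ S2 ∨ ∃ R' ∈ S2, R' ∉ S1 ∧ Q.schema R \ Q.uniq = Q.schema R' \ Q.uniq := by
  by_cases hR2 : R ∈ S2
  · exact Or.inl hR2
  have hRE : R ∈ Q.E := CQ.reachable_subset h1.1 hR
  have hel := CQ.earEligible_of_notMem_reachable h2.1 hRE hR2
  obtain ⟨R', hR', hsub⟩ := CQ.exists_dominating_of_reachable h2.1 hRE
  obtain ⟨R'', hR'', hsub'⟩ :=
    CQ.exists_dominating_of_reachable h1.1 (CQ.reachable_subset h2.1 hR')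
  obtain rfl := h1.eq_of_subset hR hR'' hel (hsub.trans hsub')
  refine Or.inr ⟨R', hR', fun hmem => hR2 ?_, hsub.antisymm hsub'⟩
  exact h1.eq_of_subset hR hmem hel hsub ▸ hR'
end

section
/- In a conjunctive query Q = (V, E, ȳ), the anchor relation is transitive: if R' ∈ E is an anchor of R ∈ E, R'' ∈ E is an anchor of R', and R'' ≠ R, then R'' is an anchor of R. -/
open Finset

/-- The anchor relation is transitive: if `R'` is an anchor of `R`,
`R''` is an anchor of `R'`, and `R'' ≠ R`, then `R''` is an anchor of `R`. -/
theorem anchor_transitive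
    {α ρ : Type} [DecidableEq α] [DecidableEq ρ]
    (Q : CQ α ρ) (R R' R'' : ρ)
    (h1 : Q.IsAnchor R R') (h2 : Q.IsAnchor R' R'') (hne : R'' ≠ R) :
    Q.IsAnchor R R'' := by
  obtain ⟨hR, _, _, h1⟩ := h1
  obtain ⟨_, hR'', _, h2⟩ := h2
  have hsub : Q.schema R' \ Q.uniq ⊆ Q.schema R'' :=
    h2.elim (fun h => h.1) (fun h => h.trans Finset.inter_subset_left)
  have lift {x} (hx : x ∈ Q.schema R \ Q.uniq) (hx' : x ∈ Q.schema R') : x ∈ Q.schema R'' :=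
    hsub (Finset.mem_sdiff.mpr ⟨hx', (Finset.mem_sdiff.mp hx).2⟩)
  refine ⟨hR, hR'', hne, h1.imp (fun h => ⟨fun x hx => lift hx (h.1 hx), h.2⟩) fun h x hx => ?_⟩
  obtain ⟨hx', hy⟩ := Finset.mem_inter.mp (h hx)
  exact Finset.mem_inter.mpr ⟨lift hx hx', hy⟩
end

section
/- Let Q = (V, E, ȳ) be a conjunctive query whose relational hypergraph H contains a chordless path P = {v1, ..., v_{k−1}} of length k. Let T be any generalized join tree of Q, let n1 be a node of T with v1 ∈ n1 and v_i ∉ n1 for all i ∈ [2, k−1], and let n_l be a node of T with v_{k−1} ∈ n_l and v_i ∉ n_l for all i ∈ [1, k−2]. Then every attribute of P appears in some node on the tree path between n1 and n_l, and this tree path contains at least k nodes. -/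
open Finset

section TreePaths

variable {N : Type} {parent : N → N}

theorem Anc.refl (u : N) : Anc parent u u := ⟨0, rfl⟩

theorem Anc.trans {a b c : N} (hab : Anc parent a b) (hbc : Anc parent b c) : Anc parent a c := by
  obtain ⟨n, rfl⟩ := hab
  obtain ⟨m, rfl⟩ := hbc
  exact ⟨n + m, Function.iterate_add_apply _ _ _ _⟩

theorem Anc.iterate_of_le {n m : ℕ} (h : n ≤ m) (x : N) :
    Anc parent (parent^[m] x) (parent^[n] x) :=
  ⟨m - n, by rw [← Function.iterate_add_apply, Nat.sub_add_cancel h]⟩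

theorem Anc.total {a b x : N} (ha : Anc parent a x) (hb : Anc parent b x) :
    Anc parent a b ∨ Anc parent b a := by
  obtain ⟨n, rfl⟩ := ha
  obtain ⟨m, rfl⟩ := hb
  exact (le_total m n).imp (Anc.iterate_of_le · x) (Anc.iterate_of_le · x)

/-- Lowest common ancestors exist in a rooted tree. -/
theorem exists_lca {root : N} (hroot : ∀ v, Anc parent root v) (a b : N) :
    ∃ l, Anc parent l a ∧ Anc parent l b ∧
      ∀ z, Anc parent z a → Anc parent z b → Anc parent z l := by
  classical
  have hex : ∃ n, Anc parent (parent^[n] a) b := by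
    obtain ⟨n, hn⟩ := hroot a
    exact ⟨n, hn ▸ hroot b⟩
  refine ⟨parent^[Nat.find hex] a, ⟨_, rfl⟩, Nat.find_spec hex, ?_⟩
  rintro _ ⟨j, rfl⟩ hj
  exact Anc.iterate_of_le (Nat.find_min' hex hj) a

theorem OnPath.left (u v : N) : OnPath parent u v u := ⟨.inl (.refl u), fun _ h _ => h⟩

theorem OnPath.right (u v : N) : OnPath parent u v v := ⟨.inr (.refl v), fun _ _ h => h⟩

theorem OnPath.symm {u v w : N} (h : OnPath parent u v w) : OnPath parent v u w :=
  ⟨h.1.symm, fun z hv hu => h.2 z hu hv⟩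

/-- The path between two nodes is covered by the two paths through any third node. -/
theorem OnPath.split {u v w : N} (h : OnPath parent u v w) (p : N) :
    OnPath parent u p w ∨ OnPath parent p v w := by
  wlog hwu : Anc parent w u generalizing u v
  · exact (this h.symm (h.1.resolve_left hwu)).symm.imp OnPath.symm OnPath.symm
  by_contra! hcon
  obtain ⟨h₁, h₂⟩ := hcon
  have h₁' : ∃ z, Anc parent z u ∧ Anc parent z p ∧ ¬ Anc parent z w := by
    by_contra! hz
    exact h₁ ⟨.inl hwu, hz⟩
  obtain ⟨z, hzu, hzp, hzw⟩ := h₁'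
  have hwp : Anc parent w p := ((Anc.total hzu hwu).resolve_left hzw).trans hzp
  have h₂' : ∃ z, Anc parent z p ∧ Anc parent z v ∧ ¬ Anc parent z w := by
    by_contra! hz
    exact h₂ ⟨.inl hwp, hz⟩
  obtain ⟨y, hyp, hyv, hyw⟩ := h₂'
  rcases Anc.total hzp hyp with hzy | hyz
  · exact hzw (h.2 z hzu (hzy.trans hyv))
  · exact hyw (h.2 y (hyz.trans hzu) hyv)

/-- Any three nodes of a rooted tree have a median. -/
theorem exists_median {root : N} (hroot : ∀ v, Anc parent root v) (a b c : N) :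
    ∃ m, OnPath parent a b m ∧ OnPath parent a c m ∧ OnPath parent c b m := by
  obtain ⟨x, hxa, hxb, hx⟩ := exists_lca hroot a b
  obtain ⟨y, hya, hyc, hy⟩ := exists_lca hroot a c
  obtain ⟨w, hwc, hwb, hw⟩ := exists_lca hroot c b
  have key : ∀ m, (m = x ∨ m = y ∨ m = w) → Anc parent x m → Anc parent y m → Anc parent w m →
      ∃ m, OnPath parent a b m ∧ OnPath parent a c m ∧ OnPath parent c b m := by
    intro m hm hxm hym hwm
    refine ⟨m, ⟨?_, fun z h₁ h₂ => (hx z h₁ h₂).trans hxm⟩,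
      ⟨?_, fun z h₁ h₂ => (hy z h₁ h₂).trans hym⟩,
      ⟨?_, fun z h₁ h₂ => (hw z h₁ h₂).trans hwm⟩⟩ <;>
    rcases hm with rfl | rfl | rfl <;> tauto
  rcases Anc.total hxa hya with hxy | hyx
  · rcases Anc.total hyc hwc with hyw | hwy
    · exact key w (by tauto) (hxy.trans hyw) hyw (.refl w)
    · exact key y (by tauto) hxy (.refl y) hwy
  · rcases Anc.total hxb hwb with hxw | hwx
    · exact key w (by tauto) hxw (hyx.trans hxw) (.refl w)
    · exact key x (by tauto) (.refl x) hyx hwx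

/-- A set of nodes that contains the path between any two of its members. -/
def PathConvex (parent : N → N) (S : Set N) : Prop :=
  ∀ u ∈ S, ∀ v ∈ S, ∀ w, OnPath parent u v w → w ∈ S

theorem PathConvex.union {C D : Set N} (hC : PathConvex parent C) (hD : PathConvex parent D)
    (h : (C ∩ D).Nonempty) : PathConvex parent (C ∪ D) := by
  obtain ⟨p, hpC, hpD⟩ := h
  rintro u (hu | hu) v (hv | hv) w hw
  · exact .inl (hC u hu v hv w hw)
  · exact (hw.split p).imp (hC u hu p hpC w) (hD p hpD v hv w)
  · exact (hw.split p).symm.imp (hC p hpC v hv w) (hD u hu p hpD w)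
  · exact .inr (hD u hu v hv w hw)

/-- The union of a chain of path-convex sets, each meeting the next, is path-convex. -/
theorem PathConvex.chain {S : ℕ → Set N} (hS : ∀ i, PathConvex parent (S i)) {a b : ℕ}
    (hab : a ≤ b) (hne : ∀ i, a ≤ i → i < b → (S i ∩ S (i + 1)).Nonempty) :
    PathConvex parent {w | ∃ j, a ≤ j ∧ j ≤ b ∧ w ∈ S j} := by
  induction b, hab using Nat.le_induction with
  | base =>
    have : {w | ∃ j, a ≤ j ∧ j ≤ a ∧ w ∈ S j} = S a := by
      ext w
      exact ⟨fun ⟨j, h₁, h₂, h⟩ => le_antisymm h₂ h₁ ▸ h, fun h => ⟨a, le_rfl, le_rfl, h⟩⟩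
    exact this ▸ hS a
  | succ b hab ih =>
    have hunion : {w | ∃ j, a ≤ j ∧ j ≤ b + 1 ∧ w ∈ S j} =
        {w | ∃ j, a ≤ j ∧ j ≤ b ∧ w ∈ S j} ∪ S (b + 1) := by
      ext w
      constructor
      · rintro ⟨j, h₁, h₂, h⟩
        rcases Nat.le_succ_iff.mp h₂ with h₂ | rfl
        · exact .inl ⟨j, h₁, h₂, h⟩
        · exact .inr h
      · rintro (⟨j, h₁, h₂, h⟩ | h)
        · exact ⟨j, h₁, h₂.trans b.le_succ, h⟩
        · exact ⟨b + 1, hab.trans b.le_succ, le_rfl, h⟩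
    rw [hunion]
    refine (ih fun i h₁ h₂ => hne i h₁ (h₂.trans b.lt_succ_self)).union (hS _) ?_
    obtain ⟨p, hp, hp'⟩ := hne b hab b.lt_succ_self
    exact ⟨p, ⟨b, hab, le_rfl, hp⟩, hp'⟩

end TreePaths

theorem GJT.exists_attrs_subset {α ρ : Type} [DecidableEq α] [DecidableEq ρ] {Q : CQ α ρ}
    (T : GJT Q) (w : T.N) : ∃ R ∈ Q.E, T.attrs w ⊆ Q.schema R := by
  rw [T.attrs_def w]
  cases h : T.label w with
  | inl R => exact ⟨R, T.label_input_mem w R h, subset_rfl⟩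
  | inr s => exact T.label_gen_guarded w s h

/-- Lemma on tree paths. Every attribute of a chordless path of
length `k` appears on the join-tree path between suitable endpoint nodes `n1`, `nl`,
and that tree path contains at least `k` nodes. -/
theorem chordless_path_realized_in_join_tree
    {α ρ : Type} [DecidableEq α] [DecidableEq ρ]
    (Q : CQ α ρ) (k : ℕ) (hk : 3 ≤ k)
    (v : ℕ → α) (e : ℕ → ρ) (hP : Q.IsChordless k v e)
    (T : GJT Q) (n1 nl : T.N)
    (hn1 : v 1 ∈ T.attrs n1) (hn1' : ∀ i, 2 ≤ i → i ≤ k - 1 → v i ∉ T.attrs n1)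
    (hnl : v (k - 1) ∈ T.attrs nl) (hnl' : ∀ i, 1 ≤ i → i ≤ k - 2 → v i ∉ T.attrs nl) :
    (∀ i, 1 ≤ i → i ≤ k - 1 → ∃ w, OnPath T.parent n1 nl w ∧ v i ∈ T.attrs w) ∧
    k ≤ Set.ncard {w : T.N | OnPath T.parent n1 nl w} := by
  unfold CQ.IsChordless at hP
  rw [if_neg (by omega), if_neg (by omega)] at hP
  obtain ⟨-, hE, -, -, hadj, hshort, -, -⟩ := hP
  have hfar : ∀ i j w, 1 ≤ i → i + 1 < j → j ≤ k - 1 → v i ∈ T.attrs w → v j ∉ T.attrs w := by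
    intro i j w h₁ h₂ h₃ hi hj
    obtain ⟨R, hR, hsub⟩ := T.exists_attrs_subset w
    exact hshort i j h₁ h₂ h₃ R hR ⟨hsub hi, hsub hj⟩
  let S : ℕ → Set T.N := fun i => {w | v i ∈ T.attrs w}
  have hS : ∀ i, PathConvex T.parent (S i) := fun i u hu w hw => (T.connect (v i) u w · hu hw)
  have hne : ∀ i, 1 ≤ i → i ≤ k - 2 → (S i ∩ S (i + 1)).Nonempty := by
    intro i h₁ h₂
    obtain ⟨w, hw⟩ := T.cover _ (hE (i + 1) (by omega) (by omega))
    refine ⟨w, ?_⟩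
    have hattrs : T.attrs w = Q.schema (e (i + 1)) := by rw [T.attrs_def w, hw]; rfl
    simpa only [S, Set.mem_inter_iff, Set.mem_ofPred_eq, hattrs] using hadj i h₁ h₂
  have hmid : ∀ i, ∃ m, 1 ≤ i → i ≤ k - 2 →
      OnPath T.parent n1 nl m ∧ v i ∈ T.attrs m ∧ v (i + 1) ∈ T.attrs m := by
    intro i
    by_cases hi : 1 ≤ i ∧ i ≤ k - 2
    swap
    · exact ⟨n1, fun h₁ h₂ => absurd ⟨h₁, h₂⟩ hi⟩
    obtain ⟨h₁, h₂⟩ := hi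
    obtain ⟨w, hw, hw'⟩ := hne i h₁ h₂
    obtain ⟨m, hm, hm₁, hm₂⟩ := exists_median T.reach_root n1 nl w
    obtain ⟨a, ha₁, ha₂, ha⟩ := PathConvex.chain hS h₁ (fun j h h' => hne j h (by omega))
      n1 ⟨1, le_rfl, h₁, hn1⟩ w ⟨i, h₁, le_rfl, hw⟩ m hm₁
    obtain ⟨b, hb₁, hb₂, hb⟩ := PathConvex.chain hS (show i + 1 ≤ k - 1 by omega)
      (fun j h h' => hne j (by omega) (by omega))
      w ⟨i + 1, le_rfl, by omega, hw'⟩ nl ⟨k - 1, by omega, le_rfl, hnl⟩ m hm₂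
    have hab : ¬ a + 1 < b := fun h => hfar a b m ha₁ h hb₂ ha hb
    obtain rfl : a = i := by omega
    obtain rfl : b = a + 1 := by omega
    exact ⟨m, fun _ _ => ⟨hm, ha, hb⟩⟩
  choose m hm using hmid
  constructor
  · intro i h₁ h₂
    rcases Nat.lt_or_ge i (k - 1) with h | h
    · obtain ⟨h₃, h₄, -⟩ := hm i h₁ (by omega)
      exact ⟨m i, h₃, h₄⟩
    · obtain rfl : i = k - 1 := le_antisymm h₂ h
      exact ⟨nl, .right _ _, hnl⟩
  · classical
    have := T.fin
    have hinj : Set.InjOn m (Finset.Icc 1 (k - 2)) := by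
      have hlt : ∀ i j, 1 ≤ i → j ≤ k - 2 → i < j → m i ≠ m j := fun i j h₁ h₂ h heq =>
        hfar i (j + 1) (m i) h₁ (by omega) (by omega) (hm i h₁ (by omega)).2.1
          (heq ▸ (hm j (by omega) h₂).2.2)
      intro i hi j hj heq
      simp only [Finset.coe_Icc, Set.mem_Icc] at hi hj
      rcases lt_trichotomy i j with h | h | h
      · exact absurd heq (hlt i j hi.1 hj.2 h)
      · exact h
      · exact absurd heq.symm (hlt j i hj.1 hi.2 h)
    have hnl_notMem : nl ∉ (Finset.Icc 1 (k - 2)).image m := by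
      simp only [Finset.mem_image, Finset.mem_Icc, not_exists, not_and]
      rintro i ⟨h₁, h₂⟩ rfl
      exact hnl' i h₁ h₂ (hm i h₁ h₂).2.1
    have hn1_notMem : n1 ∉ insert nl ((Finset.Icc 1 (k - 2)).image m) := by
      simp only [Finset.mem_insert, Finset.mem_image, Finset.mem_Icc, not_or, not_exists, not_and]
      refine ⟨?_, ?_⟩
      · rintro rfl
        exact hnl' 1 le_rfl (by omega) hn1
      · rintro i ⟨h₁, h₂⟩ rfl
        exact hn1' (i + 1) (by omega) (by omega) (hm i h₁ h₂).2.2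
    have hcard : (insert n1 (insert nl ((Finset.Icc 1 (k - 2)).image m))).card = k := by
      rw [Finset.card_insert_of_notMem hn1_notMem, Finset.card_insert_of_notMem hnl_notMem,
        Finset.card_image_of_injOn hinj, Nat.card_Icc]
      omega
    calc k = _ := hcard.symm
      _ = _ := (Set.ncard_coe_finset _).symm
      _ ≤ _ := Set.ncard_le_ncard ?_ (Set.toFinite _)
    intro w hw
    simp only [Finset.coe_insert, Finset.coe_image, Finset.coe_Icc, Set.mem_insert_iff,
      Set.mem_image, Set.mem_Icc] at hw
    rcases hw with rfl | rfl | ⟨i, ⟨h₁, h₂⟩, rfl⟩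
    · exact .left _ _
    · exact .right _ _
    · exact (hm i h₁ h₂).1
end

section
/- For every d ≥ 1, the Boolean star query Q_d() ← R1(x1, ..., x_d), R2(x1), R3(x2), ..., R_{d+1}(x_d) has dimension exactly d, i.e., dim(Q_d) = d. -/
open Finset

namespace CQ

variable {α ρ : Type} [DecidableEq α]

section Bounds

variable [Fintype α] (Q : CQ α ρ)

theorem dimVal_le_card (Vc : Finset α) (Ec : Finset ρ) (K : Finset α) :
    Q.dimVal Vc Ec K ≤ Fintype.card α := by
  unfold dimVal
  split_ifs <;> exact Finset.card_le_univ _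

variable [DecidableEq ρ]

theorem localDim_le_card (Vc : Finset α) (Ec : Finset ρ) :
    Q.localDim Vc Ec ≤ Fintype.card α :=
  csSup_le' <| by
    rintro _ ⟨_, K, _, rfl⟩
    exact Q.dimVal_le_card Vc Ec K

theorem dim_le_card : Q.dim ≤ Fintype.card α :=
  csSup_le' <| by
    rintro _ ⟨Vc, Ec, _, _, rfl⟩
    exact Q.localDim_le_card Vc Ec

variable {Q}

theorem IsKeySet.dimVal_le_localDim {Vc : Finset α} {Ec Nb : Finset ρ} {K : Finset α}
    (h : Q.IsKeySet Vc Ec Nb K) : Q.dimVal Vc Ec K ≤ Q.localDim Vc Ec := by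
  refine le_csSup ⟨Fintype.card α, ?_⟩ ⟨Nb, K, h, rfl⟩
  rintro _ ⟨_, K', _, rfl⟩
  exact Q.dimVal_le_card Vc Ec K'

theorem localDim_le_dim {Vc : Finset α} {Ec : Finset ρ}
    (hVc : Q.IsConnSubset Vc) (hEc : Q.IsActive Vc Ec) : Q.localDim Vc Ec ≤ Q.dim := by
  refine le_csSup ⟨Fintype.card α, ?_⟩ ⟨Vc, Ec, hVc, hEc, rfl⟩
  rintro _ ⟨Vc', Ec', _, _, rfl⟩
  exact Q.localDim_le_card Vc' Ec'

end Bounds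

theorem card_le_dimVal (Q : CQ α ρ) (Vc : Finset α) (Ec : Finset ρ) (K : Finset α) :
    K.card ≤ Q.dimVal Vc Ec K := by
  unfold dimVal
  split_ifs
  · exact le_rfl
  · exact Finset.card_le_card Finset.subset_union_left

theorem isConnSubset_empty (Q : CQ α ρ) : Q.IsConnSubset ∅ := by
  simp [IsConnSubset]

theorem isActive_empty_singleton {Q : CQ α ρ} {R : ρ} (hR : R ∈ Q.E) : Q.IsActive ∅ {R} := by
  simpa [IsActive] using hR

end CQ

/-- The Boolean star query
`Q_d() ← R1(x1,…,xd), R2(x1), …, R_{d+1}(xd)` has dimension exactly `d`. -/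
theorem boolean_star_query_dimension
    (d : ℕ) (hd : 1 ≤ d)
    (Q : CQ (Fin d) (Option (Fin d)))
    (hV : Q.V = Finset.univ) (hE : Q.E = Finset.univ) (hy : Q.y = ∅)
    (hc : Q.schema none = Finset.univ)
    (hs : ∀ i : Fin d, Q.schema (some i) = {i}) :
    Q.dim = d := by
  have hkey : Q.IsKeySet ∅ {none} (Finset.univ.image some) Finset.univ := by
    refine ⟨?_, fun R => R.getD ⟨0, hd⟩, ?_, ?_, ?_⟩
    · intro R hR
      obtain ⟨i, -, rfl⟩ := Finset.mem_image.mp hR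
      simp [hE]
    · intro R hR
      obtain ⟨i, -, rfl⟩ := Finset.mem_image.mp hR
      simp [hs, hc, CQ.Vstar]
    · intro R hR S hS h
      obtain ⟨i, -, rfl⟩ := Finset.mem_image.mp (Finset.mem_coe.mp hR)
      obtain ⟨j, -, rfl⟩ := Finset.mem_image.mp (Finset.mem_coe.mp hS)
      simpa using h
    · ext i
      simp
  refine le_antisymm (by simpa using Q.dim_le_card) ?_
  calc d = (Finset.univ : Finset (Fin d)).card := by simp
    _ ≤ Q.dimVal ∅ {none} Finset.univ := Q.card_le_dimVal _ _ _
    _ ≤ Q.localDim ∅ {none} := hkey.dimVal_le_localDim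
    _ ≤ Q.dim := CQ.localDim_le_dim Q.isConnSubset_empty
      (CQ.isActive_empty_singleton (by simp [hE]))
end
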